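/- arXiv:2005.08093 — 4 statements merged into one kernel-verified Lean document; each statement's English description precedes it below -/
import Mathlib

section
/- Let (A, m_A) → (B, m_B) → (C, m_C) be flat local homomorphisms of commutative Noetherian local rings such that the ideal m_A B (generated in B by the image of m_A) is m_B-primary and the ideal m_B C is m_C-primary. Then the lengths ℓ_C(C/m_A C), ℓ_C(C/m_B C) and ℓ_B(B/m_A B) are finite and ℓ_C(C/m_A C) = ℓ_C(C/m_B C) · ℓ_B(B/m_A B). -/
/-!
STATEMENT 0: For flat local homomorphisms (A,m_A) → (B,m_B) → (C,m_C) of commutative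
Noetherian local rings with m_A B being m_B-primary and m_B C being m_C-primary, the
lengths ℓ_C(C/m_A C), ℓ_C(C/m_B C), ℓ_B(B/m_A B) are finite and
ℓ_C(C/m_A C) = ℓ_C(C/m_B C) · ℓ_B(B/m_A B).

The length of a module is formalized as the Krull dimension of its lattice of submodules
(`Order.krullDim (Submodule R M)`), which agrees with the usual Jordan–Hölder length.
Finiteness of length together with the multiplicative identity is expressed by the
existence of natural numbers realizing the three lengths with a = b * c.
An ideal I of a Noetherian local ring (B, m_B) is m_B-primary iff its radical is m_B.
-/

open IsLocalRing

/-- The length of a module, as the Krull dimension of its submodule lattice. -/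
noncomputable def moduleLength (R M : Type*) [Ring R] [AddCommGroup M] [Module R M] :
    WithBot ℕ∞ :=
  Order.krullDim (Submodule R M)

theorem moduleLength_eq_coe_length (R M : Type*) [Ring R] [AddCommGroup M] [Module R M] :
    moduleLength R M = (Module.length R M : WithBot ℕ∞) :=
  (Module.coe_length R M).symm

theorem length_quotient_ne_top_of_radical_eq_maximalIdeal {R : Type*} [CommRing R]
    [IsNoetherianRing R] [IsLocalRing R] {I : Ideal R} (hI : I.radical = maximalIdeal R) :
    Module.length R (R ⧸ I) ≠ ⊤ := by
  have : IsArtinianRing (R ⧸ I) := quotient_artinian_of_mem_minimalPrimes_of_isLocalRing I <| by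
    rw [← Ideal.radical_minimalPrimes, hI, Ideal.minimalPrimes_eq_subsingleton_self]
    rfl
  rw [Module.length_eq_of_surjective (R := R ⧸ I) (S := R) Ideal.Quotient.mk_surjective]
  exact Module.length_ne_top

theorem length_quotient_map_maximalIdeal_eq_mul {A B C : Type*} [CommRing A] [CommRing B]
    [CommRing C] [IsLocalRing A] [IsLocalRing B] [IsLocalRing C]
    [Algebra A B] [Algebra B C] [Algebra A C] [IsScalarTower A B C]
    [IsLocalHom (algebraMap B C)] [Module.Flat B C] :
    Module.length C (C ⧸ (maximalIdeal A).map (algebraMap A C)) =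
      Module.length C (C ⧸ (maximalIdeal B).map (algebraMap B C)) *
        Module.length B (B ⧸ (maximalIdeal A).map (algebraMap A B)) := by
  rw [mul_comm, ← length_baseChange B C, IsScalarTower.algebraMap_eq A B C, ← Ideal.map_map]
  exact (Algebra.TensorProduct.quotIdealMapEquivTensorQuot C
    ((maximalIdeal A).map (algebraMap A B))).toLinearEquiv.length_eq

theorem statement0 {A B C : Type*} [CommRing A] [CommRing B] [CommRing C]
    [IsNoetherianRing A] [IsNoetherianRing B] [IsNoetherianRing C]
    [IsLocalRing A] [IsLocalRing B] [IsLocalRing C]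
    [Algebra A B] [Algebra B C] [Algebra A C] [IsScalarTower A B C]
    [IsLocalHom (algebraMap A B)] [IsLocalHom (algebraMap B C)]
    [Module.Flat A B] [Module.Flat B C]
    (hAB : (Ideal.map (algebraMap A B) (maximalIdeal A)).radical = maximalIdeal B)
    (hBC : (Ideal.map (algebraMap B C) (maximalIdeal B)).radical = maximalIdeal C) :
    ∃ a b c : ℕ,
      moduleLength C (C ⧸ Ideal.map (algebraMap A C) (maximalIdeal A)) = ((a : ℕ∞) : WithBot ℕ∞) ∧
      moduleLength C (C ⧸ Ideal.map (algebraMap B C) (maximalIdeal B)) = ((b : ℕ∞) : WithBot ℕ∞) ∧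
      moduleLength B (B ⧸ Ideal.map (algebraMap A B) (maximalIdeal A)) = ((c : ℕ∞) : WithBot ℕ∞) ∧
      a = b * c := by
  have hb := length_quotient_ne_top_of_radical_eq_maximalIdeal hBC
  have hc := length_quotient_ne_top_of_radical_eq_maximalIdeal hAB
  obtain ⟨b, hb⟩ := ENat.ne_top_iff_exists.mp hb
  obtain ⟨c, hc⟩ := ENat.ne_top_iff_exists.mp hc
  refine ⟨b * c, b, c, ?_, ?_, ?_, rfl⟩
  · rw [moduleLength_eq_coe_length, length_quotient_map_maximalIdeal_eq_mul (B := B), ← hb, ← hc,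
      Nat.cast_mul]
  · rw [moduleLength_eq_coe_length, hb]
  · rw [moduleLength_eq_coe_length, hc]
end

section
/- Let (A, m) → (B, n) be a local homomorphism of commutative Noetherian local rings such that the residue field A/m has characteristic zero, the ideal mB is n-primary, and B/n is a finite field extension of A/m. Let I ⊆ B⊗_A B be the ideal generated by the elements b⊗1 − 1⊗b for b ∈ B, and regard B⊗_A B as a B-module via the left factor b ↦ b⊗1. Then for every integer N with N ≥ ℓ_B(B/mB), one has ℓ_B( (B⊗_A B) / (I^N + n·(B⊗_A B)) ) = ℓ_B(B/mB), where n·(B⊗_A B) denotes the ideal of B⊗_A B generated by the elements u⊗1 for u ∈ n. -/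
/-!
STATEMENT 4: Let (A,m) → (B,n) be a local homomorphism of commutative Noetherian local
rings such that A/m has characteristic zero, mB is n-primary, and B/n is finite over A/m.
Let I ⊆ B ⊗_A B be the ideal generated by the b⊗1 − 1⊗b, and regard B ⊗_A B as a
B-module via the left factor.  Then for every N ≥ ℓ_B(B/mB),
ℓ_B( (B⊗_A B) / (I^N + n·(B⊗_A B)) ) = ℓ_B(B/mB).

Length is formalized as the Krull dimension of the submodule lattice.
"mB is n-primary" is encoded as: the radical of mB is n.  The ideal n·(B⊗_A B)
generated by the u⊗1, u ∈ n, is `Ideal.map (algebraMap B (B ⊗[A] B)) n` (the algebra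
structure of B on B ⊗[A] B is via the left factor, b ↦ b⊗1).
-/

open IsLocalRing TensorProduct

section

open Polynomial

/-- If `u` and `v` are roots of `P` modulo `K`, and the derivative of `P` at `u` is a unit,
then `u - v` lies in `(u - v)² + K`. -/
theorem sub_mem_span_sq_sup_of_aeval_mem {A C : Type*} [CommRing A] [CommRing C] [Algebra A C]
    (K : Ideal C) (P : A[X]) (u v : C) (hu : aeval u P ∈ K) (hv : aeval v P ∈ K)
    (hd : IsUnit (aeval u (derivative P))) :
    u - v ∈ Ideal.span {(u - v) ^ 2} ⊔ K := by
  obtain ⟨c, hc⟩ := (P.map (algebraMap A C)).binomExpansion u (v - u)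
  simp only [add_sub_cancel, eval_map_algebraMap, derivative_map] at hc
  rw [← Ideal.unit_mul_mem_iff_mem _ hd]
  have h : aeval u (derivative P) * (u - v) = c * (u - v) ^ 2 + (aeval u P - aeval v P) := by
    rw [hc]; ring
  rw [h]
  exact add_mem (Ideal.mem_sup_left (Ideal.mul_mem_left _ _ (Ideal.mem_span_singleton_self _)))
    (Ideal.mem_sup_right (sub_mem hu hv))

theorem Ideal.sup_pow_le {C : Type*} [CommRing C] (I K : Ideal C) (n : ℕ) :
    (I ⊔ K) ^ n ≤ I ^ n ⊔ K := by
  induction n with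
  | zero => simp
  | succ n ih =>
    rw [pow_succ, pow_succ]
    refine (Ideal.mul_mono_left ih).trans ?_
    rw [Ideal.sup_mul, Ideal.mul_sup]
    have h₁ : I ^ n * K ≤ K := Ideal.mul_le_right
    have h₂ : K * (I ⊔ K) ≤ K := Ideal.mul_le_left
    exact sup_le (sup_le_sup_left h₁ _) (h₂.trans le_sup_right)

theorem Ideal.le_pow_sup_of_le_sq_sup {C : Type*} [CommRing C] (J K : Ideal C)
    (h : J ≤ J ^ 2 ⊔ K) (n : ℕ) (hn : n ≠ 0) : J ≤ J ^ n ⊔ K := by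
  induction n, Nat.one_le_iff_ne_zero.mpr hn using Nat.le_induction with
  | base => simp
  | succ n hn ih =>
    have hmul : J ^ 2 ≤ J ^ (n + 1) ⊔ K := by
      rw [pow_succ, pow_one]
      refine (Ideal.mul_mono_left (ih (by omega))).trans ?_
      rw [Ideal.sup_mul, ← pow_succ]
      have hK : K * J ≤ K := Ideal.mul_le_left
      exact sup_le_sup_left hK _
    exact h.trans (sup_le hmul le_sup_right)

theorem IsLocalRing.maximalIdeal_pow_eq_bot_of_length_le {R : Type*} [CommRing R] [IsLocalRing R]
    (N : ℕ) (h : Module.length R R ≤ N) : maximalIdeal R ^ N = ⊥ := by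
  have hfl : IsFiniteLength R R := Module.length_ne_top_iff.mp (ne_top_of_le_ne_top (by simp) h)
  have : IsNoetherianRing R := (isFiniteLength_iff_isNoetherian_isArtinian.mp hfl).1
  by_contra hN
  have hne (i : ℕ) (hi : i ≤ N) : maximalIdeal R ^ i ≠ ⊥ := fun h0 =>
    hN (le_bot_iff.mp (h0 ▸ Ideal.pow_le_pow_right hi))
  have hlt (i : ℕ) (hi : i ≤ N) : maximalIdeal R ^ (i + 1) < maximalIdeal R ^ i := by
    refine lt_of_le_of_ne (Ideal.pow_le_pow_right i.le_succ) fun heq => hne i hi ?_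
    refine Submodule.eq_bot_of_le_smul_of_le_jacobson_bot (maximalIdeal R) _
      (IsNoetherian.noetherian _) ?_ (maximalIdeal_le_jacobson _)
    rw [smul_eq_mul, ← pow_succ', heq]
  have hco (i : ℕ) (hi : i ≤ N) : (i : ℕ∞) ≤ Order.coheight (maximalIdeal R ^ i) := by
    induction i with
    | zero => simp
    | succ i ih =>
      push_cast
      exact (add_le_add_left (ih (by omega)) 1).trans
        (Order.coheight_add_one_le (hlt i (by omega)))
  have hlen := (add_le_add_left (hco N le_rfl) 1).trans
    (Order.coheight_add_one_le (bot_lt_iff_ne_bot.mpr hN))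
  have := (Module.length_eq_coheight (R := R) (M := R) ▸ hlen).trans h
  norm_cast at this
  omega

theorem IsLocalRing.length_eq_of_residue_surjective {B R : Type*} [CommRing B] [CommRing R]
    [IsLocalRing B] [IsLocalRing R] [Algebra B R] [IsLocalHom (algebraMap B R)]
    (h : Function.Surjective ((residue R).comp (algebraMap B R))) :
    Module.length B R = Module.length R R := by
  have hs : Function.Surjective (algebraMap (ResidueField B) (ResidueField R)) := by
    intro x
    obtain ⟨b, rfl⟩ := h x
    exact ⟨residue B b, rfl⟩
  have h1 : Module.length (ResidueField B) (ResidueField R) = 1 := by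
    rw [Module.length_eq_of_surjective (R := ResidueField R) hs, Module.length_eq_one]
  rw [IsLocalRing.length_restrictScalars B R R, h1, mul_one]

/-- The ideal `I ^ N + n (B ⊗[A] B)` is the kernel of `b ⊗ c ↦ ψ b * π c`, where `π` is the
quotient map and `ψ` (the structure map of `R`) factors through a coefficient field. -/
theorem ker_lift_eq {A B R : Type*} [CommRing A] [CommRing B] [CommRing R]
    [IsLocalRing A] [IsLocalRing B] [IsLocalRing R] [Algebra A B] [Algebra A R] [Algebra B R]
    [IsScalarTower A B R] [IsLocalHom (algebraMap A B)]
    (π : B →ₐ[A] R) (hπ : Function.Surjective π)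
    (hker : RingHom.ker π = (maximalIdeal A).map (algebraMap A B))
    (hψ : ∀ b ∈ maximalIdeal B, algebraMap B R b = 0)
    (hψπ : ∀ b, algebraMap B R b - π b ∈ maximalIdeal R)
    (N : ℕ) (hN : maximalIdeal R ^ N = ⊥)
    (hsep : ∀ b : B, ∃ P : A[X], aeval b P ∈ maximalIdeal B ∧
      IsUnit (aeval b (derivative P)) ∧ aeval (algebraMap B R b) P = 0) :
    RingHom.ker (Algebra.TensorProduct.lift (Algebra.ofId B R) π (fun _ _ => .all _ _)) =
      Ideal.span {x : B ⊗[A] B | ∃ b : B, x = b ⊗ₜ[A] (1 : B) - (1 : B) ⊗ₜ[A] b} ^ N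
        + (maximalIdeal B).map (algebraMap B (B ⊗[A] B)) := by
  set φ := Algebra.TensorProduct.lift (Algebra.ofId B R) π (fun _ _ => .all _ _) with hφ
  set I := Ideal.span {x : B ⊗[A] B | ∃ b : B, x = b ⊗ₜ[A] (1 : B) - (1 : B) ⊗ₜ[A] b}
  set K := (maximalIdeal B).map (algebraMap B (B ⊗[A] B))
  have hN0 : N ≠ 0 := by
    rintro rfl
    rw [pow_zero, Ideal.one_eq_top] at hN
    exact top_ne_bot hN
  have hφt (b c : B) : φ (b ⊗ₜ c) = algebraMap B R b * π c := by
    simp [hφ, Algebra.ofId_apply]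
  have hKl (b : B) (hb : b ∈ maximalIdeal B) : b ⊗ₜ[A] (1 : B) ∈ K :=
    Ideal.mem_map_of_mem (algebraMap B (B ⊗[A] B)) hb
  have hKr (b : B) (hb : π b = 0) : (1 : B) ⊗ₜ[A] b ∈ K := by
    have hb' : b ∈ (maximalIdeal A).map (algebraMap A B) := by rwa [← hker]
    suffices (maximalIdeal A).map (algebraMap A B) ≤
        K.comap (Algebra.TensorProduct.includeRight : B →ₐ[A] B ⊗[A] B) from this hb'
    rw [Ideal.map_le_iff_le_comap]
    intro a ha
    simp only [Ideal.mem_comap, AlgHom.commutes]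
    exact hKl _ (map_nonunit (algebraMap A B) a ha)
  set J := Ideal.span {x : B ⊗[A] B |
    ∃ b c : B, π c = algebraMap B R b ∧ x = b ⊗ₜ[A] (1 : B) - (1 : B) ⊗ₜ[A] c}
  have hJsq : J ≤ J ^ 2 ⊔ K := by
    refine Ideal.span_le.mpr ?_
    rintro _ ⟨b, c, hbc, rfl⟩
    obtain ⟨P, h1, h2, h3⟩ := hsep b
    have hl : aeval (b ⊗ₜ[A] (1 : B)) P = (aeval b P) ⊗ₜ[A] (1 : B) :=
      aeval_algHom_apply (Algebra.TensorProduct.includeLeft : B →ₐ[A] B ⊗[A] B) b P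
    have hl' : aeval (b ⊗ₜ[A] (1 : B)) (derivative P) = (aeval b (derivative P)) ⊗ₜ[A] (1 : B) :=
      aeval_algHom_apply (Algebra.TensorProduct.includeLeft : B →ₐ[A] B ⊗[A] B) b _
    have hr : aeval ((1 : B) ⊗ₜ[A] c) P = (1 : B) ⊗ₜ[A] (aeval c P) :=
      aeval_algHom_apply (Algebra.TensorProduct.includeRight : B →ₐ[A] B ⊗[A] B) c P
    have hπc : π (aeval c P) = 0 := by rw [← aeval_algHom_apply, hbc, h3]
    have hmem := sub_mem_span_sq_sup_of_aeval_mem K P (b ⊗ₜ 1) (1 ⊗ₜ c)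
      (hl ▸ hKl _ h1) (hr ▸ hKr _ hπc) (hl' ▸ h2.map (algebraMap B (B ⊗[A] B)))
    have hle : Ideal.span {(b ⊗ₜ[A] (1 : B) - (1 : B) ⊗ₜ[A] c) ^ 2} ≤ J ^ 2 := by
      rw [Ideal.span_singleton_le_iff_mem]
      have hJ : b ⊗ₜ[A] (1 : B) - (1 : B) ⊗ₜ[A] c ∈ J := Ideal.subset_span ⟨b, c, hbc, rfl⟩
      exact Ideal.pow_mem_pow hJ 2
    exact sup_le_sup_right hle K hmem
  have hJI : J ≤ I ⊔ K := by
    refine Ideal.span_le.mpr ?_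
    rintro _ ⟨b, c, hbc, rfl⟩
    have hmem : b - c ∈ maximalIdeal B := by
      have h := hψπ b
      rw [← hbc, ← map_sub] at h
      rw [mem_maximalIdeal, mem_nonunits_iff] at h ⊢
      exact fun hu => h (by simpa using (hu.neg.map π))
    have : b ⊗ₜ[A] (1 : B) - (1 : B) ⊗ₜ[A] c =
        (c ⊗ₜ[A] (1 : B) - (1 : B) ⊗ₜ[A] c) + (b - c) ⊗ₜ[A] (1 : B) := by
      rw [TensorProduct.sub_tmul]; ring
    rw [this]
    exact add_mem (Ideal.mem_sup_left (Ideal.subset_span ⟨c, rfl⟩))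
      (Ideal.mem_sup_right (hKl _ hmem))
  have hJN : J ≤ I ^ N ⊔ K :=
    (Ideal.le_pow_sup_of_le_sq_sup J K hJsq N hN0).trans (sup_le
      ((Ideal.pow_right_mono hJI N).trans (Ideal.sup_pow_le I K N)) le_sup_right)
  rw [Submodule.add_eq_sup]
  apply le_antisymm
  · intro x hx
    have key : ∀ x : B ⊗[A] B, ∃ y : B, x - (1 : B) ⊗ₜ[A] y ∈ J := by
      intro x
      induction x with
      | zero => exact ⟨0, by simp⟩
      | add x y hx hy =>
        obtain ⟨u, hu⟩ := hx
        obtain ⟨v, hv⟩ := hy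
        exact ⟨u + v, by rw [TensorProduct.tmul_add, add_sub_add_comm]; exact add_mem hu hv⟩
      | tmul b d =>
        obtain ⟨c, hc⟩ := hπ (algebraMap B R b)
        refine ⟨c * d, ?_⟩
        have : b ⊗ₜ[A] d - (1 : B) ⊗ₜ[A] (c * d) =
            ((1 : B) ⊗ₜ[A] d) * (b ⊗ₜ[A] (1 : B) - (1 : B) ⊗ₜ[A] c) := by
          simp [mul_sub, mul_comm]
        rw [this]
        exact Ideal.mul_mem_left _ _ (Ideal.subset_span ⟨b, c, hc, rfl⟩)
    have hJφ : J ≤ RingHom.ker φ := by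
      refine Ideal.span_le.mpr ?_
      rintro _ ⟨b, c, hbc, rfl⟩
      simp [RingHom.mem_ker, hφt, hbc]
    obtain ⟨y, hy⟩ := key x
    have hy0 : π y = 0 := by
      have h1 := hJφ hy
      rw [RingHom.mem_ker, map_sub, RingHom.mem_ker.mp hx, hφt] at h1
      simpa using h1
    rw [← sub_add_cancel x ((1 : B) ⊗ₜ[A] y)]
    exact add_mem (hJN hy) (Ideal.mem_sup_right (hKr y hy0))
  · refine sup_le ?_ ?_
    · have hI : I ≤ (maximalIdeal R).comap φ := by
        refine Ideal.span_le.mpr ?_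
        rintro _ ⟨b, rfl⟩
        simpa [hφt] using hψπ b
      refine (Ideal.pow_right_mono hI N).trans ((Ideal.le_comap_pow φ N).trans ?_)
      rw [hN]
      exact le_rfl
    · rw [Ideal.map_le_iff_le_comap]
      intro b hb
      rw [Ideal.mem_comap, RingHom.mem_ker, AlgHom.commutes, hψ b hb]

theorem length_quotient_eq {A B R : Type*} [CommRing A] [CommRing B] [CommRing R]
    [IsLocalRing A] [IsLocalRing B] [IsLocalRing R] [Algebra A B] [Algebra A R]
    [IsLocalHom (algebraMap A B)]
    (π ψ : B →ₐ[A] R) (hπ : Function.Surjective π)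
    (hker : RingHom.ker π = (maximalIdeal A).map (algebraMap A B))
    (hψ : ∀ b ∈ maximalIdeal B, ψ b = 0)
    (hψπ : ∀ b, ψ b - π b ∈ maximalIdeal R)
    (N : ℕ) (hN : maximalIdeal R ^ N = ⊥)
    (hsep : ∀ b : B, ∃ P : A[X], aeval b P ∈ maximalIdeal B ∧
      IsUnit (aeval b (derivative P)) ∧ aeval (ψ b) P = 0) :
    Module.length B ((B ⊗[A] B) ⧸
      (Ideal.span {x : B ⊗[A] B | ∃ b : B, x = b ⊗ₜ[A] (1 : B) - (1 : B) ⊗ₜ[A] b} ^ N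
        + (maximalIdeal B).map (algebraMap B (B ⊗[A] B)))) = Module.length R R := by
  let : Algebra B R := ψ.toRingHom.toAlgebra
  have : IsScalarTower A B R := .of_algebraMap_eq fun a => (ψ.commutes a).symm
  have : IsLocalHom (algebraMap B R) := ⟨fun b hb => by
    by_contra hnu
    exact not_isUnit_zero (hψ b ((mem_maximalIdeal b).mpr hnu) ▸ hb)⟩
  rw [← ker_lift_eq π hπ hker hψ hψπ N hN hsep,
    (Ideal.quotientKerAlgEquivOfSurjective (f := Algebra.TensorProduct.lift (Algebra.ofId B R) π
      (fun _ _ => .all _ _)) fun r => ?_).toLinearEquiv.length_eq]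
  · refine IsLocalRing.length_eq_of_residue_surjective fun x => ?_
    obtain ⟨r, rfl⟩ := residue_surjective x
    obtain ⟨b, rfl⟩ := hπ r
    refine ⟨b, ?_⟩
    rw [RingHom.comp_apply, ← sub_eq_zero, ← map_sub, residue_eq_zero_iff]
    exact hψπ b
  · obtain ⟨b, rfl⟩ := hπ r
    exact ⟨1 ⊗ₜ b, by simp⟩

/-- A coefficient field of `B ⧸ mB`, viewed as a map from `B`. -/
theorem exists_algHom_quotient {A B : Type*} [CommRing A] [CommRing B]
    [IsLocalRing A] [IsLocalRing B] [Algebra A B] [IsLocalHom (algebraMap A B)]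
    [CharZero (ResidueField A)] [IsLocalRing (B ⧸ (maximalIdeal A).map (algebraMap A B))]
    (hle : (maximalIdeal A).map (algebraMap A B) ≤ maximalIdeal B)
    (hfin : (ResidueField.map (algebraMap A B)).Finite) (N : ℕ)
    (hN : maximalIdeal (B ⧸ (maximalIdeal A).map (algebraMap A B)) ^ N = ⊥) :
    ∃ ψ : B →ₐ[A] B ⧸ (maximalIdeal A).map (algebraMap A B),
      (∀ b ∈ maximalIdeal B, ψ b = 0) ∧
      (∀ b, ψ b - Ideal.Quotient.mkₐ A _ b ∈ maximalIdeal _) ∧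
      ∀ b : B, ∃ P : A[X], aeval b P ∈ maximalIdeal B ∧
        IsUnit (aeval b (derivative P)) ∧ aeval (ψ b) P = 0 := by
  set mB := (maximalIdeal A).map (algebraMap A B)
  let : Algebra (ResidueField A) (B ⧸ mB) :=
    (Ideal.quotientMap mB (algebraMap A B) Ideal.le_comap_map).toAlgebra
  have : IsScalarTower A (ResidueField A) (B ⧸ mB) := .of_algebraMap_eq fun _ => rfl
  have : Module.Finite (ResidueField A) (ResidueField B) := by
    rw [← RingHom.finite_algebraMap]
    exact hfin
  have : Algebra.FormallyEtale (ResidueField A) (ResidueField B) := .of_isSeparable _ _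
  let g : B ⧸ mB →ₐ[ResidueField A] ResidueField B :=
    { Ideal.Quotient.factor hle with
      commutes' := fun x => by
        obtain ⟨a, rfl⟩ := residue_surjective x
        rfl }
  have hgm (b : B) : g (Ideal.Quotient.mk mB b) = residue B b := rfl
  have hg : Function.Surjective g := fun x => by
    obtain ⟨b, rfl⟩ := residue_surjective x
    exact ⟨_, hgm b⟩
  have hker : RingHom.ker g ≤ maximalIdeal (B ⧸ mB) := le_maximalIdeal (RingHom.ker_ne_top g)
  have hnil : IsNilpotent (RingHom.ker (g : B ⧸ mB →+* ResidueField B)) :=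
    ⟨N, le_bot_iff.mp (hN ▸ Ideal.pow_right_mono hker N)⟩
  let σ : ResidueField B →ₐ[ResidueField A] B ⧸ mB :=
    Algebra.FormallySmooth.liftOfSurjective (.id _ _) g hg hnil
  have hσ (x : ResidueField B) : g (σ x) = x :=
    Algebra.FormallySmooth.liftOfSurjective_apply (.id _ _) g hg hnil x
  refine ⟨(σ.restrictScalars A).comp (IsScalarTower.toAlgHom A B (ResidueField B)), ?_, ?_, ?_⟩
  · intro b hb
    have : residue B b = 0 := (residue_eq_zero_iff b).mpr hb
    exact (congrArg σ this).trans (map_zero σ)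
  · intro b
    refine hker ?_
    change g (σ (residue B b) - Ideal.Quotient.mk mB b) = 0
    rw [map_sub, hσ, hgm, sub_self]
  · intro b
    obtain ⟨P, hP⟩ := Polynomial.map_surjective _ residue_surjective
      (minpoly (ResidueField A) (residue B b))
    have haeval (Q : A[X]) :
        residue B (aeval b Q) = aeval (residue B b) (Q.map (residue A)) := by
      rw [← ResidueField.algebraMap_eq, ← ResidueField.algebraMap_eq, aeval_map_algebraMap,
        aeval_algebraMap_apply]
    refine ⟨P, ?_, ?_, ?_⟩
    · rw [← residue_eq_zero_iff, haeval, hP, minpoly.aeval]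
    · rw [← residue_ne_zero_iff_isUnit, haeval, ← derivative_map, hP]
      exact (Algebra.IsSeparable.isSeparable (ResidueField A)
        (residue B b)).aeval_derivative_ne_zero (minpoly.aeval _ _)
    · change aeval (σ (residue B b)) P = 0
      rw [← aeval_map_algebraMap (ResidueField A), aeval_algHom_apply,
        ResidueField.algebraMap_eq, hP, minpoly.aeval, map_zero]

end

theorem statement4 {A B : Type*} [CommRing A] [CommRing B]
    [IsNoetherianRing A] [IsNoetherianRing B]
    [IsLocalRing A] [IsLocalRing B] [Algebra A B]
    [IsLocalHom (algebraMap A B)]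
    [CharZero (ResidueField A)]
    (hprim : (Ideal.map (algebraMap A B) (maximalIdeal A)).radical = maximalIdeal B)
    (hfin : (ResidueField.map (algebraMap A B)).Finite)
    (N : ℕ)
    (hN : moduleLength B (B ⧸ Ideal.map (algebraMap A B) (maximalIdeal A))
      ≤ ((N : ℕ∞) : WithBot ℕ∞)) :
    moduleLength B ((B ⊗[A] B) ⧸
        (Ideal.span {x : B ⊗[A] B | ∃ b : B, x = b ⊗ₜ[A] (1 : B) - (1 : B) ⊗ₜ[A] b} ^ N
          + Ideal.map (algebraMap B (B ⊗[A] B)) (maximalIdeal B)))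
      = moduleLength B (B ⧸ Ideal.map (algebraMap A B) (maximalIdeal A)) := by
  set mB := Ideal.map (algebraMap A B) (maximalIdeal A)
  have hle : mB ≤ maximalIdeal B := hprim ▸ Ideal.le_radical
  have hlen : Module.length B (B ⧸ mB) = Module.length (B ⧸ mB) (B ⧸ mB) :=
    Module.length_eq_of_surjective Ideal.Quotient.mk_surjective
  have : Nontrivial (B ⧸ mB) :=
    Ideal.Quotient.nontrivial_iff.mpr (ne_top_of_le_ne_top (maximalIdeal.isMaximal B).ne_top hle)
  have : IsLocalRing (B ⧸ mB) := .of_surjective' (Ideal.Quotient.mk mB) Ideal.Quotient.mk_surjective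
  have hpow : maximalIdeal (B ⧸ mB) ^ N = ⊥ := by
    refine IsLocalRing.maximalIdeal_pow_eq_bot_of_length_le N ?_
    rw [← hlen, ← WithBot.coe_le_coe, Module.coe_length]
    exact hN
  obtain ⟨ψ, hψ, hψπ, hsep⟩ := exists_algHom_quotient hle hfin N hpow
  have h := length_quotient_eq (Ideal.Quotient.mkₐ A mB) ψ Ideal.Quotient.mk_surjective
    (Ideal.mk_ker) hψ hψπ N hpow hsep
  unfold moduleLength
  rw [← Module.coe_length, ← Module.coe_length, h, hlen]
end

section
/- Let X be a nonempty Noetherian sober topological space (i.e. a Noetherian topological space in which every nonempty irreducible closed subset has a unique generic point). Let f : X → X be a continuous, closed, surjective map. Let τ : X → ℝ be a bounded upper semicontinuous function. For n ≥ 1 and x ∈ X set τ_n(x) = Σ_{k=0}^{n−1} τ(f^k(x)) and τ_{−n}(x) = sup{ τ_n(y) : y ∈ X, f^n(y) = x }. Assume that for every x ∈ X the sequence τ_{−n}(x)/n converges as n → ∞, and denote its limit by τ_−(x). Then for every nonempty closed subset Y ⊆ X, the sequence (sup_{x ∈ Y} τ_{−n}(x))/n converges as n → ∞ and lim_{n→∞}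 (sup_{x ∈ Y} τ_{−n}(x))/n = sup_{x ∈ Y} τ_−(x). -/
open Filter Topology TopologicalSpace

/-- Noetherian induction on closed sets: it suffices to treat the empty set, unions, and
irreducible closed sets all of whose proper closed subsets have the property. -/
theorem isClosed_noetherian_induction {X : Type*} [TopologicalSpace X] [NoetherianSpace X]
    {P : Set X → Prop} (empty : P ∅) (union : ∀ A B, P A → P B → P (A ∪ B))
    (irred : ∀ Z, IsClosed Z → IsIrreducible Z →
      (∀ Z', IsClosed Z' → Z' ⊂ Z → P Z') → P Z)
    (Z : Set X) (hZ : IsClosed Z) : P Z := by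
  suffices h : ∀ Z : Closeds X, P Z from h ⟨Z, hZ⟩
  intro Z
  induction Z using WellFoundedLT.induction with
  | ind Z ih =>
  have ih' : ∀ Z', IsClosed Z' → Z' ⊂ (Z : Set X) → P Z' := fun Z' hc hlt =>
    ih ⟨Z', hc⟩ hlt
  by_cases hne : (Z : Set X).Nonempty
  · by_cases hpre : IsPreirreducible (Z : Set X)
    · exact irred Z Z.isClosed ⟨hne, hpre⟩ ih'
    · rw [isPreirreducible_iff_isClosed_union_isClosed] at hpre
      push Not at hpre
      obtain ⟨A, B, hA, hB, hsub, hnA, hnB⟩ := hpre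
      have hAB : (Z : Set X) = ((Z : Set X) ∩ A) ∪ ((Z : Set X) ∩ B) := by
        rw [← Set.inter_union_distrib_left, Set.inter_eq_left.2 hsub]
      rw [hAB]
      refine union _ _ (ih' _ (Z.isClosed.inter hA) ?_) (ih' _ (Z.isClosed.inter hB) ?_)
      · exact ⟨Set.inter_subset_left, fun h => hnA fun x hx => (h hx).2⟩
      · exact ⟨Set.inter_subset_left, fun h => hnB fun x hx => (h hx).2⟩
  · rw [Set.not_nonempty_iff_eq_empty.1 hne]
    exact empty

/-- A Noetherian sober space is compact for the constructible topology: covers by open or closed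
sets have finite subcovers. -/
theorem exists_finset_cover_of_isOpen_or_isClosed {X : Type*} [TopologicalSpace X]
    [NoetherianSpace X] [QuasiSober X] {ι : Type*} (s : ι → Set X)
    (hs : ∀ i, IsOpen (s i) ∨ IsClosed (s i)) (hcov : ∀ x, ∃ i, x ∈ s i) :
    ∃ t : Finset ι, ∀ x, ∃ i ∈ t, x ∈ s i := by
  classical
  suffices h : ∀ Z, IsClosed Z → ∃ t : Finset ι, ∀ x ∈ Z, ∃ i ∈ t, x ∈ s i by
    simpa using h Set.univ isClosed_univ
  refine isClosed_noetherian_induction ⟨∅, by simp⟩ ?_ ?_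
  · rintro A B ⟨t, ht⟩ ⟨u, hu⟩
    refine ⟨t ∪ u, ?_⟩
    rintro x (hx | hx)
    · obtain ⟨i, hi, hxi⟩ := ht x hx
      exact ⟨i, Finset.mem_union_left _ hi, hxi⟩
    · obtain ⟨i, hi, hxi⟩ := hu x hx
      exact ⟨i, Finset.mem_union_right _ hi, hxi⟩
  · intro Z hZ hirr ih
    obtain ⟨z, hz⟩ := QuasiSober.sober hirr hZ
    obtain ⟨i, hi⟩ := hcov z
    rcases hs i with ho | hc
    · obtain ⟨t, ht⟩ := ih (Z \ s i) (hZ.sdiff ho)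
        ⟨Set.sdiff_subset, fun h => (h hz.mem).2 hi⟩
      refine ⟨insert i t, fun x hx => ?_⟩
      by_cases hxi : x ∈ s i
      · exact ⟨i, Finset.mem_insert_self _ _, hxi⟩
      · obtain ⟨j, hj, hxj⟩ := ht x ⟨hx, hxi⟩
        exact ⟨j, Finset.mem_insert_of_mem hj, hxj⟩
    · exact ⟨{i}, fun x hx => ⟨i, Finset.mem_singleton_self _, (hz.mem_closed_set_iff hc).1 hi hx⟩⟩

/-- The set `S` has upper density zero, in the form of a linear bound on its counting function. -/
def HasDensityZero (S : Set ℕ) : Prop :=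
  ∀ ε : ℝ, 0 < ε → ∃ K : ℝ, ∀ n : ℕ,
    ∑ k ∈ Finset.range n, S.indicator (fun _ => (1 : ℝ)) k ≤ ε * n + K

namespace HasDensityZero

theorem mono {S T : Set ℕ} (hT : HasDensityZero T) (h : S ⊆ T) : HasDensityZero S := by
  intro ε hε
  obtain ⟨K, hK⟩ := hT ε hε
  exact ⟨K, fun n => le_trans (Finset.sum_le_sum fun k _ =>
    Set.indicator_le_indicator_of_subset h (fun _ => zero_le_one) k) (hK n)⟩

theorem empty : HasDensityZero ∅ := fun ε hε => ⟨0, fun n => by simp; positivity⟩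

theorem union {S T : Set ℕ} (hS : HasDensityZero S) (hT : HasDensityZero T) :
    HasDensityZero (S ∪ T) := by
  intro ε hε
  obtain ⟨K, hK⟩ := hS (ε / 2) (half_pos hε)
  obtain ⟨L, hL⟩ := hT (ε / 2) (half_pos hε)
  refine ⟨K + L, fun n => ?_⟩
  have h : ∑ k ∈ Finset.range n, (S ∪ T).indicator (fun _ => (1 : ℝ)) k ≤
      ∑ k ∈ Finset.range n, S.indicator (fun _ => (1 : ℝ)) k +
        ∑ k ∈ Finset.range n, T.indicator (fun _ => (1 : ℝ)) k := by
    rw [← Finset.sum_add_distrib]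
    refine Finset.sum_le_sum fun k _ => ?_
    by_cases h1 : k ∈ S <;> by_cases h2 : k ∈ T <;> simp [h1, h2]
  have := hK n
  have := hL n
  linarith

theorem biUnion {ι : Type*} (t : Finset ι) (S : ι → Set ℕ)
    (h : ∀ i ∈ t, HasDensityZero (S i)) : HasDensityZero (⋃ i ∈ t, S i) := by
  classical
  induction t using Finset.induction_on with
  | empty => simpa using empty
  | insert i t _ ih =>
    rw [Finset.set_biUnion_insert]
    exact (h i (Finset.mem_insert_self _ _)).union
      (ih fun j hj => h j (Finset.mem_insert_of_mem hj))

theorem not_univ : ¬ HasDensityZero Set.univ := by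
  intro h
  obtain ⟨K, hK⟩ := h (1 / 2) (by norm_num)
  obtain ⟨n, hn⟩ := exists_nat_gt (2 * K)
  have := hK n
  simp at this
  linarith

end HasDensityZero

/-- A set of naturals whose distinct elements are more than `P` apart has at most
`n / (P + 1) + 1` elements below `n`. -/
theorem sum_indicator_le_of_gaps {S : Set ℕ} {P : ℕ}
    (h : ∀ p, 1 ≤ p → p ≤ P → ∀ k ∈ S, k + p ∉ S) (n : ℕ) :
    ∑ k ∈ Finset.range n, S.indicator (fun _ => (1 : ℝ)) k ≤ n / (P + 1) + 1 := by
  classical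
  have hcard : ((Finset.range n).filter (· ∈ S)).card ≤ (Finset.range (n / (P + 1) + 1)).card := by
    refine Finset.card_le_card_of_injOn (fun k => k / (P + 1)) ?_ ?_
    · intro k hk
      simp only [Finset.coe_filter, Finset.mem_range, Set.mem_ofPred_eq] at hk
      simp only [Finset.coe_range, Set.mem_Iio]
      exact Nat.lt_succ_of_le (Nat.div_le_div_right hk.1.le)
    · have key : ∀ k ∈ S, ∀ l ∈ S, k / (P + 1) = l / (P + 1) → ¬ k < l := by
        intro k hk l hl heq hlt
        refine h (l - k) (by omega) ?_ k hk (by rwa [Nat.add_sub_cancel' hlt.le])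
        have h1 := Nat.div_add_mod k (P + 1)
        have h2 := Nat.div_add_mod l (P + 1)
        have h3 : l % (P + 1) < P + 1 := Nat.mod_lt l (Nat.succ_pos P)
        rw [heq] at h1
        omega
      intro k hk l hl heq
      simp only [Finset.coe_filter, Finset.mem_range, Set.mem_ofPred_eq] at hk hl
      exact le_antisymm (not_lt.1 (key l hl.2 k hk.2 heq.symm)) (not_lt.1 (key k hk.2 l hl.2 heq))
  rw [Finset.card_range] at hcard
  have hsum : ∑ k ∈ Finset.range n, S.indicator (fun _ => (1 : ℝ)) k =
      ((Finset.range n).filter (· ∈ S)).card := by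
    simp [Set.indicator_apply]
  rw [hsum]
  calc ((((Finset.range n).filter (· ∈ S)).card : ℕ) : ℝ) ≤ ((n / (P + 1) + 1 : ℕ) : ℝ) := by
        exact_mod_cast hcard
    _ ≤ n / (P + 1) + 1 := by
        push_cast
        gcongr
        simpa using (Nat.cast_div_le (α := ℝ) (m := n) (n := P + 1))

/-- An orbit visits a closed set `Z` with density zero, unless it visits an irreducible closed
subset of `Z` that is mapped into itself by an iterate. -/
theorem hasDensityZero_visits {X : Type*} [TopologicalSpace X] [NoetherianSpace X]
    {f : X → X} (hf : Continuous f) (x : X) (Z : Set X) (hZ : IsClosed Z)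
    (hunv : ∀ C ⊆ Z, IsClosed C → IsIrreducible C → ∀ p, 1 ≤ p → Set.MapsTo f^[p] C C →
      ∀ k, f^[k] x ∉ C) :
    HasDensityZero {k | f^[k] x ∈ Z} := by
  revert hunv
  refine isClosed_noetherian_induction (P := fun Z => (∀ C ⊆ Z, IsClosed C → IsIrreducible C →
    ∀ p, 1 ≤ p → Set.MapsTo f^[p] C C → ∀ k, f^[k] x ∉ C) → HasDensityZero {k | f^[k] x ∈ Z})
    ?_ ?_ ?_ Z hZ
  · intro _
    simpa using HasDensityZero.empty
  · intro A B hA hB h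
    exact (hA fun C hC => h C (hC.trans Set.subset_union_left)).union
      (hB fun C hC => h C (hC.trans Set.subset_union_right))
  · intro Z hZ hirr ih h
    by_cases hper : ∃ p, 1 ≤ p ∧ Set.MapsTo f^[p] Z Z
    · obtain ⟨p, hp, hm⟩ := hper
      have := h Z subset_rfl hZ hirr p hp hm
      simpa [this] using HasDensityZero.empty
    push Not at hper
    intro ε hε
    obtain ⟨P, hP⟩ := exists_nat_one_div_lt (half_pos hε)
    set G : Set ℕ := ⋃ p ∈ Finset.Icc 1 P, {k | f^[k] x ∈ Z ∩ f^[p] ⁻¹' Z}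
    have hGd : HasDensityZero G := by
      refine HasDensityZero.biUnion _ _ fun p hp => ?_
      refine ih _ (hZ.inter (hZ.preimage (hf.iterate p))) ⟨Set.inter_subset_left, fun hsub => ?_⟩
        fun C hC => h C (hC.trans Set.inter_subset_left)
      exact hper p (Finset.mem_Icc.1 hp).1 fun y hy => (hsub hy).2
    obtain ⟨K, hK⟩ := hGd (ε / 2) (half_pos hε)
    refine ⟨K + 1, fun n => ?_⟩
    have hgap := sum_indicator_le_of_gaps (S := {k | f^[k] x ∈ Z} \ G) (P := P) (by
      intro p hp1 hpP k hk hkp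
      refine hk.2 (Set.mem_biUnion (Finset.mem_coe.2 (Finset.mem_Icc.2 ⟨hp1, hpP⟩)) ⟨hk.1, ?_⟩)
      have := hkp.1
      simp only [Set.mem_ofPred_eq] at this
      rwa [Set.mem_preimage, ← Function.iterate_add_apply, add_comm p k]) n
    have hle : ∑ k ∈ Finset.range n, {k | f^[k] x ∈ Z}.indicator (fun _ => (1 : ℝ)) k ≤
        ∑ k ∈ Finset.range n, ({k | f^[k] x ∈ Z} \ G).indicator (fun _ => (1 : ℝ)) k +
          ∑ k ∈ Finset.range n, G.indicator (fun _ => (1 : ℝ)) k := by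
      rw [← Finset.sum_add_distrib]
      refine Finset.sum_le_sum fun k _ => ?_
      by_cases h1 : f^[k] x ∈ Z <;> by_cases h2 : k ∈ G <;> simp [h1, h2]
    have hnP : (n : ℝ) / (P + 1) ≤ ε / 2 * n := by
      have := mul_le_mul_of_nonneg_right hP.le (Nat.cast_nonneg (α := ℝ) n)
      rwa [one_div_mul_eq_div] at this
    have := hK n
    linarith

theorem IsClosedMap.iterate_self {X : Type*} [TopologicalSpace X] {f : X → X}
    (hf : IsClosedMap f) : ∀ n : ℕ, IsClosedMap f^[n]
  | 0 => IsClosedMap.id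
  | n + 1 => (hf.iterate_self n).comp hf

/-- An upper semicontinuous function does not decrease under specialization. -/
theorem UpperSemicontinuous.le_of_specializes {X : Type*} [TopologicalSpace X] {τ : X → ℝ}
    (hτ : UpperSemicontinuous τ) {x y : X} (h : x ⤳ y) : τ x ≤ τ y := by
  have hc := hτ.isClosed_preimage (τ x)
  exact h.mem_closed hc (Set.mem_preimage.2 Set.self_mem_Ici)

theorem UpperSemicontinuous.birkhoffSum {X : Type*} [TopologicalSpace X] {τ : X → ℝ}
    (hτ : UpperSemicontinuous τ) {f : X → X} (hf : Continuous f) (n : ℕ) :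
    UpperSemicontinuous (birkhoffSum f τ n) :=
  upperSemicontinuous_sum fun i _ => hτ.comp (hf.iterate i)

theorem abs_birkhoffSum_le {X : Type*} {τ : X → ℝ} {M : ℝ} (hM : ∀ x, |τ x| ≤ M) (f : X → X)
    (n : ℕ) (x : X) : |birkhoffSum f τ n x| ≤ n * M := by
  refine (Finset.abs_sum_le_sum_abs _ _).trans ?_
  refine (Finset.sum_le_card_nsmul _ _ M fun i _ => hM _).trans ?_
  simp

/-- Among the irreducible closed sets visited by the orbit of `x` and mapped into themselves by some
iterate of `f`, there is a minimal one. -/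
theorem exists_minimal_visited_periodic {X : Type*} [TopologicalSpace X] [NoetherianSpace X]
    {f : X → X} (hf : Continuous f) (x : X) :
    ∃ C : Set X, Minimal (fun C => IsClosed C ∧ IsIrreducible C ∧
      (∃ p, 1 ≤ p ∧ Set.MapsTo f^[p] C C) ∧ ∃ k, f^[k] x ∈ C) C := by
  have hex : ∃ C : Closeds X, IsIrreducible (C : Set X) ∧
      (∃ p, 1 ≤ p ∧ Set.MapsTo f^[p] (C : Set X) C) ∧ ∃ k, f^[k] x ∈ C := by
    by_contra hno
    push Not at hno
    refine HasDensityZero.not_univ ?_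
    simpa using hasDensityZero_visits hf x Set.univ isClosed_univ
      fun C _ hC hirr p hp hm => hno ⟨C, hC⟩ hirr ⟨p, hp, hm⟩
  obtain ⟨C, hC, hmin⟩ := WellFounded.has_min (wellFounded_lt (α := Closeds X))
    {C : Closeds X | IsIrreducible (C : Set X) ∧
      (∃ p, 1 ≤ p ∧ Set.MapsTo f^[p] (C : Set X) C) ∧ ∃ k, f^[k] x ∈ C} hex
  refine ⟨C, ⟨C.isClosed, hC⟩, fun C' hC' hle => ?_⟩
  by_contra hnle
  exact hmin ⟨C', hC'.1⟩ hC'.2 ⟨hle, hnle⟩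

/-- If the Birkhoff sums along the orbit of `x` grow at rate at least `a`, then the orbit enters the
closure of a periodic point along whose orbit they grow at any given rate smaller than `a`. -/
theorem exists_periodic_specializes_of_le_birkhoffSum {X : Type*} [TopologicalSpace X]
    [NoetherianSpace X] [QuasiSober X] [T0Space X] {f : X → X} (hf : Continuous f)
    (hfcl : IsClosedMap f) {τ : X → ℝ} (hτ : UpperSemicontinuous τ) {M : ℝ}
    (hM : ∀ x, |τ x| ≤ M) {a a' : ℝ} (ha : a' < a) (x : X)
    (hx : ∀ n : ℕ, a * n ≤ birkhoffSum f τ n x) :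
    ∃ (η : X) (p m : ℕ), 1 ≤ p ∧ f^[p] η = η ∧ η ⤳ f^[m] x ∧
      ∃ K : ℝ, ∀ n : ℕ, a' * n - K ≤ birkhoffSum f τ n η := by
  have hM0 : 0 ≤ M := (abs_nonneg _).trans (hM x)
  obtain ⟨C, ⟨hCc, hCi, ⟨p, hp, hmaps⟩, m, hm⟩, hmin⟩ := exists_minimal_visited_periodic hf x
  obtain ⟨η, hη⟩ := QuasiSober.sober hCi hCc
  have himg : ∀ C' : Set X, IsClosed C' → IsIrreducible C' → ∀ q, 1 ≤ q →
      Set.MapsTo f^[q] C' C' → ∀ k, f^[k] x ∈ C' → ∀ j, f^[j] '' C' ⊆ C → C ⊆ f^[j] '' C' := by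
    intro C' hc hi q hq hmq k hk j hj
    refine hmin ⟨hfcl.iterate_self j _ hc, hi.image _ (hf.iterate j).continuousOn,
      ⟨q, hq, ?_⟩, j + k, ?_⟩ hj
    · rintro _ ⟨y, hy, rfl⟩
      refine ⟨f^[q] y, hmq hy, ?_⟩
      rw [← Function.iterate_add_apply, ← Function.iterate_add_apply, add_comm]
    · rw [Function.iterate_add_apply]
      exact ⟨_, hk, rfl⟩
  have hper : Function.IsPeriodicPt f p η := by
    have heq : f^[p] '' C = C := hmaps.image_subset.antisymm
      (himg C hCc hCi p hp hmaps m hm p hmaps.image_subset)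
    have h := hη.image (hf.iterate p)
    rw [heq, hCc.closure_eq] at h
    exact h.eq hη
  have hsp : η ⤳ f^[m] x := hη.specializes hm
  refine ⟨η, p, m, hp, hper, hsp, ?_⟩
  set ε := (a - a') / 2 with hε
  have hε0 : 0 < ε := half_pos (sub_pos.2 ha)
  set D : ℕ → Set X := fun i => closure {f^[i] η} ∩ τ ⁻¹' Set.Ici (τ (f^[i] η) + ε)
  set x₀ := f^[m] x with hx₀
  have hDd : ∀ i < p, HasDensityZero {k | f^[k] x₀ ∈ D i} := by
    intro i hi
    refine hasDensityZero_visits hf x₀ _ (isClosed_closure.inter (hτ.isClosed_preimage _)) ?_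
    intro C' hC'D hc hirr q hq hmq k hk
    have hsub : f^[p - i] '' C' ⊆ C := by
      rintro _ ⟨y, hy, rfl⟩
      have h1 : f^[i] η ⤳ y := specializes_iff_mem_closure.2 (hC'D hy).1
      have h2 := h1.map (hf.iterate (p - i))
      rw [← Function.iterate_add_apply, Nat.sub_add_cancel hi.le, hper.eq] at h2
      exact h2.mem_closed hCc hη.mem
    rw [hx₀, ← Function.iterate_add_apply] at hk
    obtain ⟨c, hc', hcη⟩ := himg C' hc hirr q hq hmq _ hk _ hsub hη.mem
    have h3 : f^[i] η = f^[q * p] c := by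
      have h4 : f^[i + (q - 1) * p] η = f^[i] η := by
        rw [Function.iterate_add_apply, (hper.const_mul (q - 1)).eq]
      rw [← h4, ← hcη, ← Function.iterate_add_apply]
      congr 2
      obtain ⟨r, rfl⟩ := Nat.exists_eq_add_of_le' hq
      simp only [Nat.add_sub_cancel, add_mul, one_mul]
      omega
    have h5 : f^[q * p] c ∈ C' := by
      rw [Function.iterate_mul]
      exact hmq.iterate p hc'
    rw [← h3] at h5
    have h6 := (hC'D h5).2
    simp only [Set.mem_preimage, Set.mem_Ici] at h6
    linarith
  have hS := HasDensityZero.biUnion (Finset.range p) (fun i => {k | f^[k] x₀ ∈ D i})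
    fun i hi => hDd i (Finset.mem_range.1 hi)
  set S : Set ℕ := ⋃ i ∈ Finset.range p, {k | f^[k] x₀ ∈ D i}
  have hpt : ∀ k, τ (f^[k] x₀) ≤ τ (f^[k] η) + ε + 2 * M * S.indicator (fun _ => (1 : ℝ)) k := by
    intro k
    by_cases hk : k ∈ S
    · have h1 := (abs_le.1 (hM (f^[k] x₀))).2
      have h2 := (abs_le.1 (hM (f^[k] η))).1
      simp only [hk, Set.indicator_of_mem]
      linarith
    · simp only [hk, not_false_eq_true, Set.indicator_of_notMem, mul_zero, add_zero]
      by_contra! hlt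
      refine hk (Set.mem_biUnion (Finset.mem_coe.2 (Finset.mem_range.2
        (Nat.mod_lt k (Nat.lt_of_lt_of_le Nat.zero_lt_one hp)))) ⟨?_, ?_⟩)
      · rw [hper.iterate_mod_apply, ← specializes_iff_mem_closure]
        exact hsp.map (hf.iterate k)
      · rw [hper.iterate_mod_apply]
        exact hlt.le
  obtain ⟨K, hK⟩ := hS (ε / (2 * M + 1)) (by positivity)
  refine ⟨2 * M * K - a * m + m * M, fun n => ?_⟩
  have h1 : birkhoffSum f τ n x₀ ≤ birkhoffSum f τ n η + ε * n +
      2 * M * ∑ k ∈ Finset.range n, S.indicator (fun _ => (1 : ℝ)) k := by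
    refine (Finset.sum_le_sum fun k _ => hpt k).trans ?_
    rw [Finset.sum_add_distrib, Finset.sum_add_distrib, ← Finset.mul_sum]
    simp [birkhoffSum, mul_comm]
  have h2 := mul_le_mul_of_nonneg_left (hK n) (by positivity : 0 ≤ 2 * M)
  have h3 : 2 * M * (ε / (2 * M + 1) * n) ≤ ε * n := by
    have h : 2 * M * (ε / (2 * M + 1)) ≤ ε := by
      rw [← mul_div_assoc, div_le_iff₀ (by positivity)]
      nlinarith
    rw [← mul_assoc]
    exact mul_le_mul_of_nonneg_right h (Nat.cast_nonneg _)
  have h4 := hx (m + n)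
  rw [birkhoffSum_add] at h4
  have h5 := (abs_le.1 (abs_birkhoffSum_le hM f m x)).2
  push_cast at h4
  have h6 : a' * n = a * n - 2 * (ε * n) := by rw [hε]; ring
  linarith

/-- Every point of the closure of a cycle has backward orbits along which the Birkhoff sums grow at
least as fast as along the cycle. -/
theorem exists_preimage_le_birkhoffSum {X : Type*} [TopologicalSpace X] {f : X → X}
    (hf : Continuous f) (hfcl : IsClosedMap f) {τ : X → ℝ} (hτ : UpperSemicontinuous τ) {M : ℝ}
    (hM : ∀ x, |τ x| ≤ M) {a : ℝ} {η : X} {p : ℕ} (hp : 1 ≤ p) (hper : f^[p] η = η)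
    {K : ℝ} (hη : ∀ n : ℕ, a * n - K ≤ birkhoffSum f τ n η) {i : ℕ} {z : X} (hz : f^[i] η ⤳ z) :
    ∃ K' : ℝ, ∀ n : ℕ, ∃ y, f^[n] y = z ∧ a * n - K' ≤ birkhoffSum f τ n y := by
  have hM0 : 0 ≤ M := (abs_nonneg _).trans (hM z)
  have hper' : Function.IsPeriodicPt f p η := hper
  refine ⟨K + p * |a| + p * M, fun n => ?_⟩
  set j := i + (p - 1) * n with hj
  have hjn : f^[n] (f^[j] η) = f^[i] η := by
    have h : n + j = i + n * p := by
      obtain ⟨r, rfl⟩ := Nat.exists_eq_add_of_le' hp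
      simp only [hj, Nat.add_sub_cancel]
      ring
    rw [← Function.iterate_add_apply, h, Function.iterate_add_apply, (hper'.const_mul n).eq]
  have hz' : z ∈ f^[n] '' closure {f^[j] η} := by
    rw [← (hfcl.iterate_self n).closure_image_eq_of_continuous (hf.iterate n), Set.image_singleton,
      hjn]
    exact specializes_iff_mem_closure.1 hz
  obtain ⟨y, hy, rfl⟩ := hz'
  refine ⟨y, rfl, ?_⟩
  have h1 := (hτ.birkhoffSum hf n).le_of_specializes (specializes_iff_mem_closure.2 hy)
  rw [← hper'.iterate_mod_apply] at h1
  have h2 := hη (j % p + n)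
  rw [birkhoffSum_add] at h2
  have h3 := (abs_le.1 (abs_birkhoffSum_le hM f (j % p) η)).2
  have hlt : ((j % p : ℕ) : ℝ) ≤ p :=
    Nat.cast_le.2 (Nat.mod_lt j (Nat.lt_of_lt_of_le Nat.zero_lt_one hp)).le
  have h4 : ((j % p : ℕ) : ℝ) * M ≤ p * M := mul_le_mul_of_nonneg_right hlt hM0
  have h5 : -(p * |a|) ≤ a * ((j % p : ℕ) : ℝ) := by
    have h := mul_le_mul_of_nonneg_right hlt (abs_nonneg a)
    have h' := mul_le_mul_of_nonneg_left (neg_abs_le a) (Nat.cast_nonneg (α := ℝ) (j % p))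
    linarith
  push_cast at h2
  linarith

/-- If no point of `Y` has backward orbits along which the Birkhoff sums grow at a given rate, then
along orbit segments ending in `Y` the Birkhoff sums grow at most at any given larger rate. -/
theorem exists_birkhoffSum_le_of_mem {X : Type*} [TopologicalSpace X] [NoetherianSpace X]
    [QuasiSober X] [T0Space X] {f : X → X} (hf : Continuous f) (hfcl : IsClosedMap f)
    {τ : X → ℝ} (hτ : UpperSemicontinuous τ) {M : ℝ} (hM : ∀ x, |τ x| ≤ M) {a a' : ℝ}
    (ha : a' < a) (Y : Set X)
    (hY : ∀ z ∈ Y, ∀ K : ℝ, ∃ n : ℕ, ∀ y, f^[n] y = z → birkhoffSum f τ n y < a' * n - K) :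
    ∃ C : ℝ, ∀ (n : ℕ) (y : X), f^[n] y ∈ Y → birkhoffSum f τ n y ≤ a * n + C := by
  have key : ∀ x, ∃ (s : Set X) (N : ℕ), x ∈ s ∧ (IsOpen s ∨ IsClosed s) ∧ ∀ y ∈ s,
      (∃ n, 1 ≤ n ∧ n ≤ N ∧ birkhoffSum f τ n y < a * n) ∨ ∀ k, N ≤ k → f^[k] y ∉ Y := by
    intro x
    by_cases hx : ∀ n : ℕ, a * n ≤ birkhoffSum f τ n x
    · obtain ⟨η, p, m, hp, hper, hsp, K, hK⟩ :=
        exists_periodic_specializes_of_le_birkhoffSum hf hfcl hτ hM ha x hx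
      refine ⟨f^[m] ⁻¹' closure {η}, m, specializes_iff_mem_closure.1 hsp,
        Or.inr (isClosed_closure.preimage (hf.iterate m)), fun y hy => Or.inr fun k hk hkY => ?_⟩
      have hz : f^[k - m] η ⤳ f^[k] y := by
        have h := (specializes_iff_mem_closure.2 hy).map (hf.iterate (k - m))
        rwa [← Function.iterate_add_apply, Nat.sub_add_cancel hk] at h
      obtain ⟨K', hK'⟩ := exists_preimage_le_birkhoffSum hf hfcl hτ hM hp hper hK hz
      obtain ⟨n, hn⟩ := hY _ hkY K'
      obtain ⟨w, hw, hle⟩ := hK' n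
      exact absurd (hn w hw) (not_lt.2 hle)
    · push Not at hx
      obtain ⟨n, hn⟩ := hx
      refine ⟨birkhoffSum f τ n ⁻¹' Set.Iio (a * n), n, hn, Or.inl ?_,
        fun y hy => Or.inl ⟨n, ?_, le_rfl, hy⟩⟩
      · exact upperSemicontinuous_iff_isOpen_preimage.1 (hτ.birkhoffSum hf n) _
      · rcases Nat.eq_zero_or_pos n with rfl | h
        · simp at hn
        · exact h
  choose s N hxs hs hN using key
  obtain ⟨t, ht⟩ := exists_finset_cover_of_isOpen_or_isClosed s hs fun x => ⟨x, hxs x⟩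
  set L := t.sup N
  refine ⟨L * (M + |a|), fun n => ?_⟩
  induction n using Nat.strong_induction_on with
  | _ n ih =>
  intro y hy
  have hM0 : 0 ≤ M := (abs_nonneg _).trans (hM y)
  rcases le_or_gt n L with hn | hn
  · have h1 := (abs_le.1 (abs_birkhoffSum_le hM f n y)).2
    have hn' : (n : ℝ) ≤ L := Nat.cast_le.2 hn
    have h2 := mul_le_mul_of_nonneg_right hn' (add_nonneg hM0 (abs_nonneg a))
    have h3 := mul_le_mul_of_nonneg_right (neg_abs_le a) (Nat.cast_nonneg (α := ℝ) n)
    linarith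
  · obtain ⟨x, hxt, hyx⟩ := ht y
    have hNL : N x ≤ L := Finset.le_sup hxt
    rcases hN x y hyx with ⟨q, hq1, hqN, hq⟩ | h
    · obtain ⟨r, rfl⟩ := Nat.exists_eq_add_of_le (hqN.trans (hNL.trans hn.le))
      have h := ih r (by omega) (f^[q] y) (by
        rwa [← Function.iterate_add_apply, add_comm r q])
      rw [birkhoffSum_add]
      push_cast
      linarith
    · exact absurd hy (h n (hNL.trans hn.le))


open Filter Topology

/-!
STATEMENT 11: Let X be a nonempty Noetherian sober topological space (every nonempty
irreducible closed subset has a unique generic point; encoded by `QuasiSober` for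
existence and `T0Space` for uniqueness).  Let f : X → X be continuous, closed and
surjective, and τ : X → ℝ bounded and upper semicontinuous.  With
τ_n(x) = Σ_{k<n} τ(f^k(x)) and τ_{−n}(x) = sup{ τ_n(y) : f^n(y) = x }, assume
τ_{−n}(x)/n converges to τ_−(x) for every x.  Then for every nonempty closed Y ⊆ X,
(sup_{x ∈ Y} τ_{−n}(x))/n converges to sup_{x ∈ Y} τ_−(x) as n → ∞.
-/

theorem statement11 {X : Type*} [TopologicalSpace X] [Nonempty X]
    [TopologicalSpace.NoetherianSpace X] [QuasiSober X] [T0Space X]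
    (f : X → X) (hfc : Continuous f) (hfcl : IsClosedMap f) (hfs : Function.Surjective f)
    (τ : X → ℝ) (hτ : UpperSemicontinuous τ) (hτb : ∃ M : ℝ, ∀ x : X, |τ x| ≤ M)
    (τminus : X → ℝ)
    (hτminus : ∀ x : X, Tendsto (fun n : ℕ =>
        (sSup {s : ℝ | ∃ y : X, f^[n] y = x ∧
          s = ∑ i ∈ Finset.range n, τ (f^[i] y)}) / n) atTop (𝓝 (τminus x)))
    (Y : Set X) (hY : IsClosed Y) (hYne : Y.Nonempty) :
    Tendsto (fun n : ℕ =>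
        (sSup {s : ℝ | ∃ x ∈ Y, s = sSup {t : ℝ | ∃ y : X, f^[n] y = x ∧
          t = ∑ i ∈ Finset.range n, τ (f^[i] y)}}) / n)
      atTop (𝓝 (sSup (τminus '' Y))) := by
  obtain ⟨M, hM⟩ := hτb
  set T : ℕ → X → ℝ := fun n x => sSup {t : ℝ | ∃ y : X, f^[n] y = x ∧
    t = ∑ i ∈ Finset.range n, τ (f^[i] y)}
  have hle : ∀ n y, birkhoffSum f τ n y ≤ T n (f^[n] y) := fun n y =>
    le_csSup ⟨n * M, by rintro _ ⟨w, -, rfl⟩; exact (abs_le.1 (abs_birkhoffSum_le hM f n w)).2⟩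
      ⟨y, rfl, rfl⟩
  have hTle : ∀ n x c, (∀ y, f^[n] y = x → birkhoffSum f τ n y ≤ c) → T n x ≤ c := by
    intro n x c h
    obtain ⟨y, hy⟩ := hfs.iterate n x
    refine csSup_le ⟨_, y, hy, rfl⟩ ?_
    rintro _ ⟨w, hw, rfl⟩
    exact h w hw
  have hTM : ∀ n x, T n x ≤ n * M := fun n x =>
    hTle n x _ fun y _ => (abs_le.1 (abs_birkhoffSum_le hM f n y)).2
  have hbdd : BddAbove (τminus '' Y) := by
    refine ⟨M, ?_⟩
    rintro _ ⟨x, -, rfl⟩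
    refine le_of_tendsto (hτminus x) ?_
    filter_upwards [eventually_gt_atTop 0] with n hn
    rw [div_le_iff₀ (Nat.cast_pos.2 hn), mul_comm]
    exact hTM n x
  have hlb : ∀ x ∈ Y, ∀ n, T n x ≤ sSup {s : ℝ | ∃ x ∈ Y, s = T n x} := fun x hx n =>
    le_csSup ⟨n * M, by rintro _ ⟨w, -, rfl⟩; exact hTM n w⟩ ⟨x, hx, rfl⟩
  refine tendsto_order.2 ⟨fun c hc => ?_, fun c hc => ?_⟩
  · obtain ⟨_, ⟨x, hxY, rfl⟩, hcx⟩ := exists_lt_of_lt_csSup (hYne.image τminus) hc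
    filter_upwards [(hτminus x).eventually (lt_mem_nhds hcx)] with n hn
    exact hn.trans_le (div_le_div_of_nonneg_right (hlb x hxY n) (Nat.cast_nonneg n))
  · obtain ⟨a, hba, hac⟩ := exists_between hc
    obtain ⟨a', hba', haa'⟩ := exists_between hba
    have hgrow : ∀ z ∈ Y, ∀ K : ℝ, ∃ n : ℕ, ∀ y, f^[n] y = z →
        birkhoffSum f τ n y < a' * n - K := by
      intro z hz K
      by_contra! hcon
      have hlim : Tendsto (fun n : ℕ => a' - K / n) atTop (𝓝 a') := by
        simpa using tendsto_const_nhds.sub (tendsto_const_div_atTop_nhds_zero_nat K)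
      have h : a' ≤ τminus z := by
        refine le_of_tendsto_of_tendsto hlim (hτminus z) ?_
        filter_upwards [eventually_gt_atTop 0] with n hn
        have hn' : (0 : ℝ) < n := Nat.cast_pos.2 hn
        obtain ⟨y, rfl, hy⟩ := hcon n
        rw [le_div_iff₀ hn', sub_mul, div_mul_cancel₀ _ hn'.ne']
        exact hy.trans (hle n y)
      exact absurd (h.trans (le_csSup hbdd ⟨z, hz, rfl⟩)) (not_le.2 hba')
    obtain ⟨C, hC⟩ := exists_birkhoffSum_le_of_mem hfc hfcl hτ hM haa' Y hgrow
    have hlim : Tendsto (fun n : ℕ => a + C / n) atTop (𝓝 a) := by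
      simpa using tendsto_const_nhds.add (tendsto_const_div_atTop_nhds_zero_nat C)
    filter_upwards [eventually_gt_atTop 0, hlim.eventually (gt_mem_nhds hac)] with n hn hnc
    have hn' : (0 : ℝ) < n := Nat.cast_pos.2 hn
    refine lt_of_le_of_lt ?_ hnc
    rw [div_le_iff₀ hn', add_mul, div_mul_cancel₀ _ hn'.ne']
    obtain ⟨x, hx⟩ := hYne
    refine csSup_le ⟨_, x, hx, rfl⟩ ?_
    rintro _ ⟨w, hw, rfl⟩
    exact hTle n w _ fun y hy => hC n y (hy ▸ hw)
end

section
/- Let (A, m) → (B, n) be a flat local homomorphism of commutative Noetherian local rings such that the ideal mB is n-primary. Let a ⊆ A be a nonzero ideal, let e = ℓ_B(B/mB), and let m_0 = max{ m ∈ ℕ : a ⊆ m^m } (this maximum is finite since a ≠ 0 and ⋂_{m} m^m = 0 by Krull's intersection theorem). Then aB is not contained in n^{e(m_0+1)}, where aB denotes the ideal of B generated by the image of a. -/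
/-!
STATEMENT 13: Let (A,m) → (B,n) be a flat local homomorphism of commutative Noetherian
local rings with mB n-primary. Let a ⊆ A be a nonzero ideal, e = ℓ_B(B/mB), and
m_0 = max{ m : a ⊆ m^m }. Then aB ⊄ n^{e(m_0+1)}.

Length is formalized as the Krull dimension of the submodule lattice; `e` is introduced
as a natural number equal to this length.  The maximum m_0 is characterized by the two
hypotheses `hm0` and `hm0max`.  "mB is n-primary" is encoded as: the radical of mB is n.
-/

open IsLocalRing

namespace Submodule

variable {R M : Type*} [CommRing R] [AddCommGroup M] [Module R M] [IsNoetherian R M]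

lemma pow_smul_top_eq_bot_or_le_coheight {I : Ideal R} (hI : I ≤ Ideal.jacobson ⊥) (n : ℕ) :
    I ^ n • (⊤ : Submodule R M) = ⊥ ∨ n ≤ Order.coheight (I ^ n • (⊤ : Submodule R M)) := by
  induction n with
  | zero => simp
  | succ n ih =>
    have hsucc : I ^ (n + 1) • (⊤ : Submodule R M) = I • (I ^ n • (⊤ : Submodule R M)) := by
      rw [pow_succ', ← smul_eq_mul, smul_assoc]
    rw [hsucc]
    rcases ih with h | h
    · simp [h]
    by_cases hle : I ^ n • (⊤ : Submodule R M) ≤ I • (I ^ n • (⊤ : Submodule R M))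
    · left
      rw [eq_bot_of_le_smul_of_le_jacobson_bot I _ (IsNoetherian.noetherian _) hle hI, smul_bot]
    · right
      push_cast
      exact (add_le_add_left h 1).trans
        (Order.coheight_add_one_le (lt_of_le_not_ge smul_le_right hle))

lemma pow_smul_top_eq_bot_of_length_le {I : Ideal R} (hI : I ≤ Ideal.jacobson ⊥) {n : ℕ}
    (hn : Module.length R M ≤ n) : I ^ n • (⊤ : Submodule R M) = ⊥ := by
  rcases pow_smul_top_eq_bot_or_le_coheight (M := M) hI n with h | h
  · exact h
  by_contra hne
  rw [Module.length_eq_coheight] at hn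
  have hlt := (add_le_add_left h 1).trans (Order.coheight_add_one_le (bot_lt_iff_ne_bot.2 hne))
  have hle : ((n + 1 : ℕ) : ℕ∞) ≤ n := by exact_mod_cast hlt.trans hn
  exact absurd (Nat.cast_le.1 hle) (by lia)

end Submodule

lemma Ideal.pow_le_of_length_quotient_le {R : Type*} [CommRing R] [IsNoetherianRing R]
    {I : Ideal R} (hI : I ≤ Ideal.jacobson ⊥) (J : Ideal R) {n : ℕ}
    (hn : Module.length R (R ⧸ J) ≤ n) : I ^ n ≤ J := by
  have h := Submodule.pow_smul_top_eq_bot_of_length_le hI hn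
  intro x hx
  have hx1 : x • (1 : R ⧸ J) = 0 := by
    rw [← Submodule.mem_bot R, ← h]
    exact Submodule.smul_mem_smul hx trivial
  rwa [Algebra.smul_def, mul_one, Ideal.Quotient.algebraMap_eq,
    Ideal.Quotient.eq_zero_iff_mem] at hx1

theorem statement13 {A B : Type*} [CommRing A] [CommRing B]
    [IsNoetherianRing A] [IsNoetherianRing B]
    [IsLocalRing A] [IsLocalRing B] [Algebra A B]
    [IsLocalHom (algebraMap A B)] [Module.Flat A B]
    (hprim : (Ideal.map (algebraMap A B) (maximalIdeal A)).radical = maximalIdeal B)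
    (a : Ideal A) (ha : a ≠ ⊥)
    (e : ℕ)
    (he : moduleLength B (B ⧸ Ideal.map (algebraMap A B) (maximalIdeal A))
      = ((e : ℕ∞) : WithBot ℕ∞))
    (m0 : ℕ) (hm0 : a ≤ maximalIdeal A ^ m0)
    (hm0max : ∀ m : ℕ, a ≤ maximalIdeal A ^ m → m ≤ m0) :
    ¬ Ideal.map (algebraMap A B) a ≤ maximalIdeal B ^ (e * (m0 + 1)) := by
  intro hle
  have hlen : Module.length B (B ⧸ Ideal.map (algebraMap A B) (maximalIdeal A)) ≤ e := by
    rw [moduleLength, ← Module.coe_length] at he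
    exact (WithBot.coe_injective he).le
  have hpow := Ideal.pow_le_of_length_quotient_le (maximalIdeal_le_jacobson ⊥) _ hlen
  have : Module.FaithfullyFlat A B := .of_flat_of_isLocalHom
  have hmap : Ideal.map (algebraMap A B) a ≤
      Ideal.map (algebraMap A B) (maximalIdeal A ^ (m0 + 1)) := by
    rw [Ideal.map_pow]
    refine hle.trans ?_
    rw [pow_mul]
    exact Ideal.pow_right_mono hpow _
  rw [Ideal.map_le_iff_le_comap, Ideal.comap_map_eq_self_of_faithfullyFlat] at hmap
  exact absurd (hm0max _ hmap) (by lia)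
end
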